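/- arXiv:1606.04425 — 2 statements merged into one kernel-verified Lean document; each statement's English description precedes it below -/
import Mathlib

section
/- The factorial sequence obeys Benford's Law in the limit: for every digit d ∈ {1, ..., 9}, the proportion, among n ∈ {1, ..., N}, of indices n for which n! has first digit d, tends to log₁₀(1 + 1/d) as N → ∞. -/
open Filter
open scoped Classical

noncomputable def zz (s : ℝ) (n : ℕ) : ℂ := Complex.exp (Complex.I * ((s * Real.log (n + 1) : ℝ) : ℂ))

lemma zz_norm (s : ℝ) (n : ℕ) : ‖zz s n‖ = 1 := by
  unfold zz; rw [mul_comm]; exact Complex.norm_exp_ofReal_mul_I _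

lemma zz_diff (s : ℝ) : Tendsto (fun n : ℕ => ((n : ℂ) + 1) * (zz s (n+1) - zz s n) - Complex.I * s * zz s n)
    atTop (nhds 0) := by
  have hd : HasDerivAt (fun x : ℝ => Complex.exp (Complex.I * ((s * Real.log (1 + x) : ℝ) : ℂ))) (Complex.I * s) 0 := by
    have h1 : HasDerivAt (fun x : ℝ => s * Real.log (1 + x)) (s * (1 / (1 + 0))) 0 :=
      (((hasDerivAt_id (0:ℝ)).const_add 1).log (by simp)).const_mul s
    have h2 := (h1.ofReal_comp.const_mul Complex.I).cexp
    simpa using h2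
  rw [hasDerivAt_iff_tendsto_slope_zero] at hd
  have h0 : Tendsto (fun n : ℕ => 1 / ((n : ℝ) + 1)) atTop (nhdsWithin 0 {0}ᶜ) := by
    rw [tendsto_nhdsWithin_iff]
    refine ⟨tendsto_one_div_add_atTop_nhds_zero_nat, Eventually.of_forall fun n => ?_⟩
    have : (0:ℝ) < 1 / ((n : ℝ) + 1) := by positivity
    simpa using this.ne'
  have h3 := hd.comp h0
  have h4 := (tendsto_sub_nhds_zero_iff.mpr h3).norm
  rw [norm_zero] at h4
  rw [tendsto_zero_iff_norm_tendsto_zero]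
  refine h4.congr fun n => ?_
  have hz : zz s (n+1) = zz s n * Complex.exp (Complex.I * ((s * Real.log (1 + 1 / ((n : ℝ) + 1)) : ℝ) : ℂ)) := by
    unfold zz
    rw [← Complex.exp_add, ← mul_add, ← Complex.ofReal_add, ← mul_add, ← Real.log_mul (by positivity) (by positivity)]
    congr 5
    push_cast
    field_simp
  rw [hz]
  have : ((n : ℂ) + 1) * (zz s n * Complex.exp (Complex.I * ((s * Real.log (1 + 1 / ((n : ℝ) + 1)) : ℝ) : ℂ)) - zz s n) - Complex.I * s * zz s n
    = zz s n * (((n : ℂ) + 1) * (Complex.exp (Complex.I * ((s * Real.log (1 + 1 / ((n : ℝ) + 1)) : ℝ) : ℂ)) - 1) - Complex.I * s) := by ring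
  rw [this, norm_mul, zz_norm, one_mul]
  simp

lemma zz_succ_sub (s : ℝ) : Tendsto (fun n : ℕ => zz s (n+1) - zz s n) atTop (nhds 0) := by
  have h := (zz_diff s).norm
  rw [norm_zero] at h
  have h1 : Tendsto (fun n : ℕ => (1 / ((n : ℝ) + 1))) atTop (nhds 0) := tendsto_one_div_add_atTop_nhds_zero_nat
  have h2 := h1.mul (h.add_const |s|)
  rw [zero_mul] at h2
  refine squeeze_zero_norm (fun n => ?_) h2
  rw [one_div, inv_mul_eq_div, le_div_iff₀ (by positivity)]
  have h3 : ‖zz s (n+1) - zz s n‖ * ((n : ℝ) + 1) = ‖((n : ℂ) + 1) * (zz s (n+1) - zz s n)‖ := by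
    rw [norm_mul, mul_comm]
    congr 1
    exact_mod_cast (Complex.norm_natCast (n+1)).symm
  have h4 : ‖Complex.I * s * zz s n‖ = |s| := by simp [zz_norm]
  rw [h3, ← h4]
  have := norm_add_le (((n : ℂ) + 1) * (zz s (n+1) - zz s n) - Complex.I * s * zz s n) (Complex.I * s * zz s n)
  simpa using this

lemma zz_avg (s : ℝ) (hs : s ≠ 0) : ∀ᶠ N : ℕ in atTop,
    ‖((N : ℝ)⁻¹ : ℝ) • ∑ n ∈ Finset.range N, zz s n‖ ≤ 4 / |s| := by
  have h1 := ((zz_diff s).add (zz_succ_sub s)).cesaro_smul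
  have h2 : Tendsto (fun N : ℕ => ‖(N : ℝ)⁻¹ • ∑ n ∈ Finset.range N,
     (((n : ℂ) + 1) * (zz s (n+1) - zz s n) - Complex.I * s * zz s n + (zz s (n+1) - zz s n))‖) atTop (nhds 0) := by
    simpa using h1.norm
  filter_upwards [h2.eventually_lt_const (show (0:ℝ) < 1 by norm_num), eventually_gt_atTop 0] with N hN hN0
  have hsum : ∑ n ∈ Finset.range N,
     (((n : ℂ) + 1) * (zz s (n+1) - zz s n) - Complex.I * s * zz s n + (zz s (n+1) - zz s n))
     = ((N : ℂ) + 1) * zz s N - zz s 0 - (1 + Complex.I * s) * ∑ n ∈ Finset.range N, zz s n := by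
    clear hN hN0
    induction N with
    | zero => simp
    | succ N ih => rw [Finset.sum_range_succ, ih, Finset.sum_range_succ]; push_cast; ring
  rw [hsum, norm_smul, norm_inv, Real.norm_natCast, inv_mul_lt_iff₀ (by positivity)] at hN
  rw [norm_smul, norm_inv, Real.norm_natCast, inv_mul_le_iff₀ (by positivity)]
  set S := ∑ n ∈ Finset.range N, zz s n
  have h5 : ‖(1 + Complex.I * s) * S‖ ≤ ‖((N : ℂ) + 1) * zz s N‖ + ‖zz s 0‖ + N * 1 := by
    have := norm_sub_le (((N : ℂ) + 1) * zz s N - zz s 0) (((N : ℂ) + 1) * zz s N - zz s 0 - (1 + Complex.I * s) * S)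
    have h6 := norm_sub_le (((N : ℂ) + 1) * zz s N) (zz s 0)
    rw [sub_sub_cancel] at this
    linarith
  have h7 : ‖(N : ℂ) + 1‖ = N + 1 := by exact_mod_cast Complex.norm_natCast (N+1)
  rw [norm_mul, norm_mul, h7, zz_norm, zz_norm] at h5
  have h8 : |s| ≤ ‖1 + Complex.I * s‖ := by
    have := Complex.abs_im_le_norm (1 + Complex.I * s)
    simpa using this
  have h9 : (1:ℝ) ≤ N := by exact_mod_cast hN0
  have h10 := mul_le_mul_of_nonneg_right h8 (norm_nonneg S)
  have : 0 < |s| := abs_pos.mpr hs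
  rw [← mul_div_assoc, le_div_iff₀ this]
  nlinarith

lemma zz_shift (t : ℝ) (u : ℕ → ℂ) (hu : ∀ n, ‖u n‖ = 1) (hz : ∀ n, u (n+1) = u n * zz t (n+1)) (k : ℕ) :
    Tendsto (fun N : ℕ => (N : ℝ)⁻¹ • ∑ n ∈ Finset.range N, (u n - u n * zz (k * t) n)) atTop (nhds 0) := by
  induction k with
  | zero => simp [zz]
  | succ k ih =>
    have h1 : Tendsto (fun n : ℕ => u n * (zz ((k+1 : ℕ) * t) (n+1) - zz ((k+1 : ℕ) * t) n)) atTop (nhds 0) := by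
      have := (zz_succ_sub ((k+1 : ℕ) * t)).norm
      rw [norm_zero] at this
      rw [tendsto_zero_iff_norm_tendsto_zero]
      simpa [hu] using this
    have h2 := h1.cesaro_smul
    have h3 : Tendsto (fun N : ℕ => (N : ℝ)⁻¹ • (u 0 * zz (k * t) 0 - u N * zz (k * t) N)) atTop (nhds 0) := by
      have h4 : Tendsto (fun N : ℕ => (N : ℝ)⁻¹ * 2) atTop (nhds 0) := by
        simpa using (tendsto_inv_atTop_nhds_zero_nat (𝕜 := ℝ)).mul_const 2
      refine squeeze_zero_norm (fun N => ?_) h4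
      rw [norm_smul, norm_inv, Real.norm_natCast]
      gcongr
      refine (norm_sub_le _ _).trans ?_
      simp [hu, zz_norm]; norm_num
    have h5 := (ih.add h2).add h3
    simp only [add_zero] at h5
    refine h5.congr fun N => ?_
    rw [← smul_add, ← smul_add]
    congr 1
    rw [← Finset.sum_range_sub' (fun n => u n * zz (k*t) n), ← Finset.sum_add_distrib, ← Finset.sum_add_distrib]
    refine Finset.sum_congr rfl fun n _ => ?_
    have : zz ((k+1 : ℕ) * t) (n+1) = zz t (n+1) * zz (k * t) (n+1) := by
      unfold zz
      rw [← Complex.exp_add]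
      congr 1
      push_cast
      ring
    rw [hz, mul_sub, this]
    ring

lemma zz_mul_conj (a b : ℝ) (n : ℕ) : zz a n * (starRingEnd ℂ) (zz b n) = zz (a - b) n := by
  unfold zz
  rw [← Complex.exp_conj, ← Complex.exp_add]
  congr 1
  simp only [map_mul, Complex.conj_I, Complex.conj_ofReal]
  push_cast
  ring

lemma exp_avg (t : ℝ) (ht : t ≠ 0) (u : ℕ → ℂ) (hu : ∀ n, ‖u n‖ = 1) (hz : ∀ n, u (n+1) = u n * zz t (n+1)) :
    Tendsto (fun N : ℕ => (N : ℝ)⁻¹ • ∑ n ∈ Finset.range N, u n) atTop (nhds 0) := by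
  have key : ∀ L : ℕ, 0 < L → ∀ᶠ N : ℕ in atTop,
      ‖(N : ℝ)⁻¹ • ∑ n ∈ Finset.range N, u n‖ ≤ 1 / L + Real.sqrt ((1 + 4 / |t|) / L) := by
    intro L hL
    have hL' : (0:ℝ) < L := by exact_mod_cast hL
    set D : ℕ → ℂ := fun n => (L : ℂ)⁻¹ * ∑ j ∈ Finset.range L, zz ((j * L : ℕ) * t) n with hD
    have hshift : Tendsto (fun N : ℕ => (N : ℝ)⁻¹ • ∑ n ∈ Finset.range N, (u n - u n * D n)) atTop (nhds 0) := by
      have h1 := (tendsto_finsetSum (Finset.range L) (fun j _ => zz_shift t u hu hz (j * L))).const_mul (L : ℂ)⁻¹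
      simp only [Finset.sum_const_zero, mul_zero] at h1
      refine h1.congr fun N => ?_
      rw [← Finset.smul_sum, mul_smul_comm, Finset.sum_comm, Finset.mul_sum]
      congr 1
      refine Finset.sum_congr rfl fun n _ => ?_
      rw [Finset.sum_sub_distrib, ← Finset.mul_sum, hD]
      have : (L : ℂ) ≠ 0 := by exact_mod_cast hL.ne'
      simp only [Finset.sum_const, Finset.card_range, nsmul_eq_mul]
      rw [mul_sub, inv_mul_cancel_left₀ this]
      ring
    have hB : ∀ᶠ N : ℕ in atTop, ∀ j ∈ Finset.range L, ∀ k ∈ Finset.range L,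
        ‖((N : ℝ)⁻¹ : ℝ) • ∑ n ∈ Finset.range N, zz ((j * L : ℕ) * t - (k * L : ℕ) * t) n‖ ≤
          (if j = k then 1 else 0) + 4 / |t| / L := by
      rw [Filter.eventually_all_finset]; intro j _
      rw [Filter.eventually_all_finset]; intro k _
      by_cases hjk : j = k
      · subst hjk
        filter_upwards [eventually_gt_atTop 0] with N hN
        have : (N : ℂ) ≠ 0 := by exact_mod_cast hN.ne'
        have h2 : 0 ≤ 4 / |t| / L := by positivity
        simp [zz, this, h2]
      · have hne : (1:ℝ) ≤ |(j:ℝ) - k| := by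
          have : (1:ℤ) ≤ |(j:ℤ) - k| := Int.one_le_abs (by omega)
          exact_mod_cast this
        have he : ((j * L : ℕ) * t - (k * L : ℕ) * t) = ((j:ℝ) - k) * (L * t) := by push_cast; ring
        have h0 : ((j * L : ℕ) * t - (k * L : ℕ) * t) ≠ 0 := by
          rw [he]
          refine mul_ne_zero (fun h => ?_) (mul_ne_zero hL'.ne' ht)
          rw [h] at hne; norm_num at hne
        filter_upwards [zz_avg _ h0] with N hN
        refine hN.trans ?_
        rw [he, if_neg hjk, zero_add, abs_mul, abs_mul, abs_of_pos hL', div_div]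
        have : 0 < |t| := abs_pos.mpr ht
        apply div_le_div_of_nonneg_left (by norm_num) (by positivity)
        nlinarith [mul_pos hL' this]
    have h3 := hshift.norm
    rw [norm_zero] at h3
    filter_upwards [hB, h3.eventually_lt_const (show (0:ℝ) < 1 / L by positivity), eventually_gt_atTop 0] with N hN hN1 hN0
    have hN' : (0:ℝ) < N := by exact_mod_cast hN0
    have hsplit : (N : ℝ)⁻¹ • ∑ n ∈ Finset.range N, u n = (N : ℝ)⁻¹ • ∑ n ∈ Finset.range N, (u n - u n * D n)
        + (N : ℝ)⁻¹ • ∑ n ∈ Finset.range N, u n * D n := by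
      rw [← smul_add, ← Finset.sum_add_distrib]; simp
    rw [hsplit]
    refine (norm_add_le _ _).trans (add_le_add hN1.le ?_)
    apply Real.le_sqrt_of_sq_le
    -- mean square
    have hms : (N : ℝ)⁻¹ * ∑ n ∈ Finset.range N, ‖D n‖ ^ 2 ≤ (1 + 4 / |t|) / L := by
      have heq : (((N : ℝ)⁻¹ * ∑ n ∈ Finset.range N, ‖D n‖ ^ 2 : ℝ) : ℂ) =
          ((L : ℂ)⁻¹)^2 * ∑ j ∈ Finset.range L, ∑ k ∈ Finset.range L,
            (((N : ℝ)⁻¹ : ℝ) • ∑ n ∈ Finset.range N, zz ((j * L : ℕ) * t - (k * L : ℕ) * t) n) := by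
        have h4 : ∀ n, ((‖D n‖ ^ 2 : ℝ) : ℂ) = ((L : ℂ)⁻¹)^2 * ∑ j ∈ Finset.range L, ∑ k ∈ Finset.range L,
            zz ((j * L : ℕ) * t - (k * L : ℕ) * t) n := by
          intro n
          rw [Complex.ofReal_pow, ← Complex.mul_conj', hD]
          simp only [map_mul, map_sum, map_inv₀, Complex.conj_natCast]
          rw [mul_mul_mul_comm, Finset.sum_mul_sum, ← sq]
          simp only [zz_mul_conj]
        rw [Complex.ofReal_mul, Complex.ofReal_sum]
        simp only [h4, Complex.real_smul]
        rw [← Finset.mul_sum, Finset.sum_comm]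
        simp only [← Finset.mul_sum]
        rw [mul_left_comm]
        congr 2
        refine Finset.sum_congr rfl fun j _ => ?_
        rw [Finset.sum_comm]
      have hnn : 0 ≤ (N : ℝ)⁻¹ * ∑ n ∈ Finset.range N, ‖D n‖ ^ 2 := by positivity
      have hno := congrArg norm heq
      rw [Complex.norm_real, Real.norm_of_nonneg hnn] at hno
      rw [hno, norm_mul, norm_pow, norm_inv, Complex.norm_natCast]
      have h5 : ‖∑ j ∈ Finset.range L, ∑ k ∈ Finset.range L,
            (((N : ℝ)⁻¹ : ℝ) • ∑ n ∈ Finset.range N, zz ((j * L : ℕ) * t - (k * L : ℕ) * t) n)‖ ≤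
            ∑ j ∈ Finset.range L, ∑ k ∈ Finset.range L, ((if j = k then 1 else 0) + 4 / |t| / L) :=
        norm_sum_le_of_le _ fun j hj => norm_sum_le_of_le _ fun k hk => hN j hj k hk
      have h6 : ∑ j ∈ Finset.range L, ∑ k ∈ Finset.range L, ((if j = k then (1:ℝ) else 0) + 4 / |t| / L)
          = L * (1 + 4 / |t|) := by
        have : ∀ j ∈ Finset.range L, ∑ k ∈ Finset.range L, ((if j = k then (1:ℝ) else 0) + 4 / |t| / L) = 1 + 4 / |t| := by
          intro j hj
          rw [Finset.sum_add_distrib, Finset.sum_ite_eq, if_pos hj]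
          simp
          field_simp
        rw [Finset.sum_congr rfl this, Finset.sum_const, Finset.card_range, nsmul_eq_mul]
      rw [h6] at h5
      calc _ ≤ ((L:ℝ)⁻¹)^2 * (L * (1 + 4 / |t|)) := by gcongr
        _ = _ := by field_simp
    refine le_trans ?_ hms
    rw [norm_smul, norm_inv, Real.norm_natCast, mul_pow]
    have h7 : ‖∑ n ∈ Finset.range N, u n * D n‖ ≤ ∑ n ∈ Finset.range N, ‖D n‖ :=
      norm_sum_le_of_le _ fun n _ => by rw [norm_mul, hu, one_mul]
    have h8 := sq_sum_le_card_mul_sum_sq (s := Finset.range N) (f := fun n => ‖D n‖)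
    rw [Finset.card_range] at h8
    calc _ ≤ ((N:ℝ)⁻¹)^2 * (N * ∑ n ∈ Finset.range N, ‖D n‖ ^ 2) := by
          gcongr
          refine le_trans ?_ h8
          gcongr
      _ = _ := by field_simp
  have hlim : Tendsto (fun L : ℕ => 1 / (L:ℝ) + Real.sqrt ((1 + 4 / |t|) / L)) atTop (nhds 0) := by
    have h1 := tendsto_const_div_atTop_nhds_zero_nat (1:ℝ)
    have h2 := (tendsto_const_div_atTop_nhds_zero_nat (1 + 4 / |t|)).sqrt
    simpa using h1.add h2
  rw [tendsto_zero_iff_norm_tendsto_zero, Metric.tendsto_atTop']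
  intro ε hε
  obtain ⟨L, hL, hL0⟩ := ((hlim.eventually_lt_const hε).and (eventually_gt_atTop 0)).exists
  obtain ⟨N₀, h⟩ := eventually_atTop.mp (key L hL0)
  exact ⟨N₀, fun n hn => by simpa using (h n hn.le).trans_lt hL⟩

open MeasureTheory in
lemma weyl_cont (y : ℕ → UnitAddCircle)
    (hy : ∀ h : ℤ, h ≠ 0 → Tendsto (fun N : ℕ => (N : ℝ)⁻¹ • ∑ n ∈ Finset.range N, (fourier h (y n) : ℂ)) atTop (nhds 0))
    (f : C(UnitAddCircle, ℂ)) :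
    Tendsto (fun N : ℕ => (N : ℝ)⁻¹ • ∑ n ∈ Finset.range N, f (y n)) atTop (nhds (∫ x, f x)) := by
  have hint : ∀ g : C(UnitAddCircle, ℂ), Integrable (fun x => g x) :=
    fun g => g.continuous.integrable_of_hasCompactSupport (HasCompactSupport.of_compactSpace _)
  have hspan : ∀ g ∈ Submodule.span ℂ (Set.range (@fourier 1)),
      Tendsto (fun N : ℕ => (N : ℝ)⁻¹ • ∑ n ∈ Finset.range N, g (y n)) atTop (nhds (∫ x : UnitAddCircle, g x)) := by
    intro g hg
    induction hg using Submodule.span_induction with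
    | mem g hg =>
      obtain ⟨h, rfl⟩ := hg
      have hI : ∫ x : UnitAddCircle, fourier h x = if h = 0 then 1 else 0 := by
        have h1 := congrFun (fourierCoeff_fourier (T := 1) h) 0
        rw [fourierCoeff] at h1
        have hv : (volume : Measure UnitAddCircle) = AddCircle.haarAddCircle := by
          have := AddCircle.volume_eq_smul_haarAddCircle (T := 1)
          simpa using this
        rw [hv]
        simpa [Pi.single_apply, eq_comm] using h1
      rw [hI]
      by_cases h0 : h = 0
      · subst h0
        simp only [if_true]
        refine tendsto_const_nhds.congr' ?_
        filter_upwards [eventually_gt_atTop 0] with N hN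
        have : (N : ℂ) ≠ 0 := by exact_mod_cast hN.ne'
        simp [this]
      · rw [if_neg h0]; exact hy h h0
    | zero => simp
    | add f g _ _ hf hg =>
      have := hf.add hg
      simp only [ContinuousMap.add_apply, Finset.sum_add_distrib, smul_add]
      rwa [integral_add (hint f) (hint g)]
    | smul c f _ hf =>
      have := hf.const_mul c
      simp only [ContinuousMap.smul_apply, smul_eq_mul, ← Finset.mul_sum]
      rw [integral_const_mul]
      refine this.congr fun N => ?_
      rw [mul_smul_comm]
  have hcl : f ∈ (Submodule.span ℂ (Set.range (@fourier 1))).topologicalClosure := by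
    rw [span_fourier_closure_eq_top]; trivial
  rw [Metric.tendsto_atTop']
  intro ε hε
  obtain ⟨g, hg, hfg⟩ := Metric.mem_closure_iff.mp hcl (ε / 3) (by positivity)
  obtain ⟨N₀, hN₀⟩ := Metric.tendsto_atTop'.mp (hspan g hg) (ε / 3) (by positivity)
  have hpt : ∀ x, ‖f x - g x‖ ≤ ε / 3 := fun x => by
    rw [← dist_eq_norm]; exact (ContinuousMap.dist_apply_le_dist x).trans hfg.le
  refine ⟨N₀, fun N hN => ?_⟩
  have hN0 : (0:ℝ) < N := by exact_mod_cast (Nat.zero_le _).trans_lt hN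
  have h1 : dist ((N : ℝ)⁻¹ • ∑ n ∈ Finset.range N, f (y n)) ((N : ℝ)⁻¹ • ∑ n ∈ Finset.range N, g (y n)) ≤ ε / 3 := by
    rw [dist_eq_norm, ← smul_sub, ← Finset.sum_sub_distrib, norm_smul, norm_inv, Real.norm_natCast, inv_mul_le_iff₀ hN0]
    refine (norm_sum_le_of_le _ fun n _ => hpt (y n)).trans ?_
    simp
  have h2 : dist (∫ x : UnitAddCircle, g x) (∫ x, f x) ≤ ε / 3 := by
    rw [dist_comm, dist_eq_norm, ← integral_sub (hint f) (hint g)]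
    have := norm_integral_le_of_norm_le_const (μ := (volume : Measure UnitAddCircle)) (Eventually.of_forall hpt)
    simpa [measureReal_def] using this
  have h3 := hN₀ N hN
  have h4 := dist_triangle4 ((N : ℝ)⁻¹ • ∑ n ∈ Finset.range N, f (y n)) ((N : ℝ)⁻¹ • ∑ n ∈ Finset.range N, g (y n)) (∫ x, g x) (∫ x, f x)
  linarith

open MeasureTheory in
lemma frontier_null (a b : ℝ) :
    (volume : Measure UnitAddCircle) (frontier ((fun x : ℝ => (x : UnitAddCircle)) '' Set.Ico a b)) = 0 := by
  refine measure_mono_null (t := {(a : UnitAddCircle), (b : UnitAddCircle)}) ?_ ?_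
  swap
  · have hs : ∀ x : UnitAddCircle, (volume : Measure UnitAddCircle) {x} = 0 := fun x => by
      have := AddCircle.volume_closedBall (T := 1) (x := x) 0
      rw [Metric.closedBall_zero] at this
      simpa using this
    rw [Set.insert_eq]
    exact measure_union_null (hs _) (hs _)
  intro x hx
  rw [frontier] at hx
  have hc : Continuous (fun x : ℝ => (x : UnitAddCircle)) := AddCircle.continuous_mk' 1
  have h1 : closure ((fun x : ℝ => (x : UnitAddCircle)) '' Set.Ico a b) ⊆ (fun x : ℝ => (x : UnitAddCircle)) '' Set.Icc a b :=
    closure_minimal (Set.image_mono Set.Ico_subset_Icc_self) (isCompact_Icc.image hc).isClosed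
  have h2 : (fun x : ℝ => (x : UnitAddCircle)) '' Set.Ioo a b ⊆ interior ((fun x : ℝ => (x : UnitAddCircle)) '' Set.Ico a b) :=
    interior_maximal (Set.image_mono Set.Ioo_subset_Ico_self) (QuotientAddGroup.isOpenMap_coe _ isOpen_Ioo)
  obtain ⟨r, hr, rfl⟩ := h1 hx.1
  have h3 : r ∉ Set.Ioo a b := fun h => hx.2 (h2 ⟨r, h, rfl⟩)
  rcases hr.1.eq_or_lt with h | h
  · left; rw [h]
  · rcases hr.2.eq_or_lt with h' | h'
    · right; rw [h']; rfl
    · exact (h3 ⟨h, h'⟩).elim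

lemma coe_eq_iff (x y : ℝ) : (x : UnitAddCircle) = y ↔ ∃ k : ℤ, x - y = k := by
  rw [← sub_eq_zero, ← AddCircle.coe_sub, AddCircle.coe_eq_zero_iff]
  simp [eq_comm]

open MeasureTheory in
lemma arc_volume (a b : ℝ) (ha : 0 ≤ a) (hb : b ≤ 1) :
    (volume : Measure UnitAddCircle) ((fun x : ℝ => (x : UnitAddCircle)) '' Set.Ico a b) = ENNReal.ofReal (b - a) := by
  set E := ((fun x : ℝ => (x : UnitAddCircle)) '' Set.Ico a b) with hE
  have hm : NullMeasurableSet E (volume : Measure UnitAddCircle) :=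
    nullMeasurableSet_of_null_frontier (frontier_null a b)
  have hp := (UnitAddCircle.measurePreserving_mk a).measure_preimage hm
  rw [← hp, Measure.restrict_apply' measurableSet_Ioc, ← Real.volume_Ioo]
  apply le_antisymm
  · calc _ ≤ volume (Set.Ioo a b ∪ {a+1}) := by
          apply measure_mono
          rintro x ⟨⟨y, hy, hxy⟩, hx⟩
          obtain ⟨k, hk⟩ := (coe_eq_iff y x).mp hxy
          have h1 : (-2:ℝ) < k := by rw [← hk]; linarith [hy.1, hx.2]
          have h2 : (k:ℝ) < 1 := by rw [← hk]; linarith [hy.2, hx.1]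
          have h1' : -2 < k := by exact_mod_cast h1
          have h2' : k < 1 := by exact_mod_cast h2
          obtain rfl | rfl : k = -1 ∨ k = 0 := by omega
          · right
            push_cast at hk
            have : x = a + 1 := by linarith [hy.1, hx.2]
            simpa using this
          · left
            push_cast at hk
            exact ⟨hx.1, by linarith [hy.2]⟩
      _ ≤ volume (Set.Ioo a b) + volume {a+1} := measure_union_le _ _
      _ = _ := by simp
  · apply measure_mono
    intro x hx
    exact ⟨⟨x, ⟨hx.1.le, hx.2⟩, rfl⟩, hx.1, by linarith [hx.2]⟩

open MeasureTheory in
lemma weyl_arc (y : ℕ → UnitAddCircle)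
    (hy : ∀ h : ℤ, h ≠ 0 → Tendsto (fun N : ℕ => (N : ℝ)⁻¹ • ∑ n ∈ Finset.range N, (fourier h (y n) : ℂ)) atTop (nhds 0))
    (a b : ℝ) (ha : 0 ≤ a) (hab : a ≤ b) (hb : b ≤ 1) :
    Tendsto (fun N : ℕ => (((Finset.range N).filter fun n => y n ∈ ((fun x : ℝ => (x : UnitAddCircle)) '' Set.Ico a b)).card : ℝ) / N)
      atTop (nhds (b - a)) := by
  rw [← tendsto_add_atTop_iff_nat 1]
  set E := ((fun x : ℝ => (x : UnitAddCircle)) '' Set.Ico a b) with hE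
  let ν : ℕ → Measure UnitAddCircle := fun N => ((N + 1 : ℕ) : ENNReal)⁻¹ • ∑ n ∈ Finset.range (N+1), Measure.dirac (y n)
  have hν : ∀ N S, ν N S = ((N + 1 : ℕ) : ENNReal)⁻¹ * (((Finset.range (N+1)).filter fun n => y n ∈ S).card : ENNReal) := by
    intro N S
    simp only [ν, Measure.smul_apply, Measure.finsetSum_apply, Measure.dirac_apply, smul_eq_mul]
    congr 1
    simp [Set.indicator_apply]
  have hprob : ∀ N, IsProbabilityMeasure (ν N) := fun N => ⟨by
    rw [hν]; simp only [Set.mem_univ, Finset.filter_true, Finset.card_range]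
    exact ENNReal.inv_mul_cancel (by simp) (ENNReal.natCast_ne_top _)⟩
  let μ : ProbabilityMeasure UnitAddCircle := ⟨volume, ⟨by simp⟩⟩
  let μs : ℕ → ProbabilityMeasure UnitAddCircle := fun N => ⟨ν N, hprob N⟩
  have hlim : Tendsto μs atTop (nhds μ) := by
    rw [ProbabilityMeasure.tendsto_iff_forall_integral_rclike_tendsto ℂ]
    intro f
    have h1 := (tendsto_add_atTop_iff_nat 1).mpr (weyl_cont y hy f.toContinuousMap)
    refine h1.congr fun N => ?_
    change _ = ∫ ω, f ω ∂(ν N)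
    simp only [ν]
    rw [integral_smul_measure, integral_finsetSum_measure]
    · rw [ENNReal.toReal_inv, ENNReal.toReal_natCast]
      simp [integral_dirac]
    · intro i _; exact integrable_dirac (by simp)
  have h2 := ProbabilityMeasure.tendsto_measure_of_null_frontier_of_tendsto' hlim (E := E) (frontier_null a b)
  change Tendsto (fun N => ν N E) atTop (nhds (volume E)) at h2
  rw [arc_volume a b ha hb] at h2
  have h3 := (ENNReal.tendsto_toReal ENNReal.ofReal_ne_top).comp h2
  rw [ENNReal.toReal_ofReal (by linarith)] at h3
  refine h3.congr fun N => ?_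
  simp only [Function.comp, hν]
  rw [ENNReal.toReal_mul, ENNReal.toReal_inv, ENNReal.toReal_natCast, ENNReal.toReal_natCast, inv_mul_eq_div]

/-- The factorial sequence obeys Benford's Law in the limit. -/
theorem factorial_benford :
    ∀ d ∈ Finset.Icc (1 : ℕ) 9,
      Tendsto (fun N : ℕ =>
          (((Finset.Icc 1 N).filter fun n =>
            Int.fract (Real.logb 10 ((Nat.factorial n : ℝ)))
              ∈ Set.Ico (Real.logb 10 (d : ℝ)) (Real.logb 10 ((d : ℝ) + 1))).card : ℝ)
            / (N : ℝ))
        atTop (nhds (Real.logb 10 (1 + 1 / (d : ℝ)))) := by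
  intro d hd
  rw [Finset.mem_Icc] at hd
  have hd1 : (1:ℝ) ≤ d := by exact_mod_cast hd.1
  have hd9 : (d:ℝ) ≤ 9 := by exact_mod_cast hd.2
  set a := Real.logb 10 (d : ℝ) with ha
  set b := Real.logb 10 ((d : ℝ) + 1) with hb
  have ha0 : 0 ≤ a := Real.logb_nonneg (by norm_num) hd1
  have hab : a ≤ b := Real.logb_le_logb_of_le (by norm_num) (by linarith) (by linarith)
  have hb1 : b ≤ 1 := by
    rw [hb, Real.logb_le_iff_le_rpow (by norm_num) (by linarith)]
    norm_num; linarith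
  have hval : Real.logb 10 (1 + 1 / (d : ℝ)) = b - a := by
    rw [ha, hb, ← Real.logb_div (by linarith) (by linarith)]
    congr 1
    field_simp
  rw [hval]
  let y : ℕ → UnitAddCircle := fun n => ((Real.logb 10 (Nat.factorial (n+1) : ℝ) : ℝ) : UnitAddCircle)
  have hlog : Real.log 10 ≠ 0 := (Real.log_pos (by norm_num)).ne'
  have hy : ∀ h : ℤ, h ≠ 0 → Tendsto (fun N : ℕ => (N : ℝ)⁻¹ • ∑ n ∈ Finset.range N, (fourier h (y n) : ℂ)) atTop (nhds 0) := by
    intro h hh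
    refine exp_avg (2 * Real.pi * h / Real.log 10) ?_ (fun n => fourier h (y n)) ?_ ?_
    · have : (h:ℝ) ≠ 0 := by exact_mod_cast hh
      have := Real.pi_ne_zero
      positivity
    · intro n; simp only [fourier_apply]; exact Circle.norm_coe _
    · intro n
      simp only [y]
      rw [fourier_coe_apply, fourier_coe_apply, zz, ← Complex.exp_add]
      congr 1
      rw [Nat.factorial_succ (n+1), Nat.cast_mul, Real.logb_mul (by positivity) (by positivity), Real.logb]
      have : (Real.log 10 : ℂ) ≠ 0 := by exact_mod_cast hlog
      push_cast
      field_simp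
      ring
  refine (weyl_arc y hy a b ha0 hab hb1).congr fun N => ?_
  congr 2
  rw [← Finset.card_image_of_injective _ (add_left_injective 1)]
  congr 1
  have hmem : ∀ n, y n ∈ ((fun x : ℝ => (x : UnitAddCircle)) '' Set.Ico a b) ↔
      Int.fract (Real.logb 10 ((Nat.factorial (n+1) : ℝ))) ∈ Set.Ico a b := by
    intro n
    constructor
    · rintro ⟨x, hx, hxy⟩
      obtain ⟨k, hk⟩ := (coe_eq_iff _ _).mp hxy.symm
      have : Int.fract (Real.logb 10 ((Nat.factorial (n+1) : ℝ))) = x := by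
        rw [Int.fract_eq_iff]
        exact ⟨ha0.trans hx.1, hx.2.trans_le hb1, k, by linarith⟩
      rwa [this]
    · intro hx
      refine ⟨_, hx, ?_⟩
      refine ((coe_eq_iff _ _).mpr ⟨⌊Real.logb 10 ((Nat.factorial (n+1) : ℝ))⌋, ?_⟩).symm
      rw [Int.self_sub_fract]
  ext m
  simp only [Finset.mem_image, Finset.mem_filter, Finset.mem_range, Finset.mem_Icc, hmem]
  constructor
  · rintro ⟨n, ⟨h1, h2⟩, rfl⟩
    exact ⟨⟨by omega, by omega⟩, h2⟩
  · rintro ⟨⟨h1, h2⟩, h3⟩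
    obtain ⟨n, rfl⟩ : ∃ n, m = n + 1 := ⟨m - 1, by omega⟩
    exact ⟨n, ⟨by omega, h3⟩, rfl⟩
end

section
/- The self-powered sequence obeys Benford's Law in the limit: for every digit d ∈ {1, ..., 9}, the proportion, among n ∈ {1, ..., N}, of indices n for which nⁿ has first digit d, tends to log₁₀(1 + 1/d) as N → ∞. -/
open Filter
open scoped Classical


lemma second_diff : Tendsto (fun n : ℕ => (n:ℝ) * (((n+2:ℕ):ℝ) * Real.log ((n+2:ℕ):ℝ) - 2 * (((n+1:ℕ):ℝ) * Real.log ((n+1:ℕ):ℝ)) + (n:ℝ) * Real.log n)) atTop (nhds 1) := by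
  have c1 : Tendsto (fun n : ℕ => ((n:ℝ)+1)) atTop atTop :=
    tendsto_atTop_add_const_right _ _ tendsto_natCast_atTop_atTop
  have c2 : Tendsto (fun n : ℕ => ((n:ℝ)+1)^2) atTop atTop := (tendsto_pow_atTop (by norm_num)).comp c1
  have h1 := (Real.tendsto_mul_log_one_add_div_atTop 1).comp c1
  have h2 := (Real.tendsto_mul_log_one_add_div_atTop (-1)).comp c1
  have h3 := (Real.tendsto_mul_log_one_add_div_atTop (-1)).comp c2
  have h4 : Tendsto (fun n : ℕ => (n:ℝ) / ((n:ℝ)+1)) atTop (nhds 1) := tendsto_natCast_div_add_atTop 1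
  have := h4.mul ((h3.add h1).sub h2)
  norm_num at this
  refine this.congr' ?_
  filter_upwards [eventually_gt_atTop 0] with n hn
  have hn' : (0:ℝ) < n := by exact_mod_cast hn
  have e1 : Real.log (1 + ((n:ℝ)+1)⁻¹) = Real.log (n+2) - Real.log (n+1) := by
    rw [← Real.log_div (by positivity) (by positivity)]; congr 1; field_simp; ring
  have e2 : Real.log (1 + -1/((n:ℝ)+1)) = Real.log n - Real.log (n+1) := by
    rw [← Real.log_div (by positivity) (by positivity)]; congr 1; field_simp; ring
  have e3 : Real.log (1 + -1/((n:ℝ)+1)^2) = Real.log (n+2) + Real.log n - 2 * Real.log (n+1) := by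
    have : 2 * Real.log ((n:ℝ)+1) = Real.log (((n:ℝ)+1)^2) := by rw [Real.log_pow]; norm_num
    rw [this, ← Real.log_mul (by positivity) (by positivity), ← Real.log_div (by positivity) (by positivity)]
    congr 1; field_simp; ring
  simp only [e1, e2, e3]
  push_cast
  field_simp
  ring

/-- `n log n`. -/
noncomputable def spF (n : ℕ) : ℝ := (n:ℝ) * Real.log n

lemma first_diff (p q : ℕ) : Tendsto (fun n : ℕ => (n:ℝ) * ((spF (n+1+p) - spF (n+1+q)) - (spF (n+p) - spF (n+q)))) atTop (nhds ((p:ℝ) - q)) := by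
  have key : ∀ p : ℕ, Tendsto (fun n : ℕ => (n:ℝ) * ((spF (n+1+p) - spF (n+1)) - (spF (n+p) - spF n))) atTop (nhds (p:ℝ)) := by
    intro p
    induction p with
    | zero => simp
    | succ p ih =>
      have h0 := second_diff.comp (tendsto_add_atTop_nat p)
      have h4 : Tendsto (fun n : ℕ => (n:ℝ) / ((n:ℝ)+p)) atTop (nhds 1) := tendsto_natCast_div_add_atTop _
      have := ih.add (h4.mul h0)
      simp only [mul_one] at this
      push_cast
      refine this.congr' ?_
      filter_upwards [eventually_gt_atTop 0] with n hn
      have hn' : (0:ℝ) < n := by exact_mod_cast hn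
      have a1 : n + 1 + (p+1) = n + p + 2 := by ring
      have a2 : n + 1 + p = n + p + 1 := by ring
      have a3 : n + (p + 1) = n + p + 1 := by ring
      rw [a1, a2, a3]
      simp only [Function.comp, spF]
      push_cast
      field_simp
      ring
  refine ((key p).sub (key q)).congr fun n => ?_
  ring

lemma mean_bound (θ : ℕ → ℝ) (t : ℝ) (ht : t ≠ 0)
    (h : Tendsto (fun n : ℕ => (n:ℝ) * (θ (n+1) - θ n)) atTop (nhds t)) (ε : ℝ) (hε : 0 < ε) :
    ∀ᶠ N : ℕ in atTop, ‖∑ n ∈ Finset.range N, Complex.exp (θ n * Complex.I)‖ ≤ (1 / |t| + ε) * N := by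
  set w : ℕ → ℂ := fun n => Complex.exp (θ n * Complex.I) with hw
  have hw1 : ∀ n, ‖w n‖ = 1 := fun n => Complex.norm_exp_ofReal_mul_I _
  -- increments
  set δ : ℕ → ℝ := fun n => θ (n+1) - θ n with hδ
  have hδ0 : Tendsto δ atTop (nhds 0) := by
    have := (tendsto_inv_atTop_nhds_zero_nat (𝕜 := ℝ)).mul h
    simp only [zero_mul] at this
    refine this.congr' ?_
    filter_upwards [eventually_gt_atTop 0] with n hn
    have hn' : (0:ℝ) < n := by exact_mod_cast hn
    simp only [hδ]; field_simp
  have hE0 : Tendsto (fun n => Complex.exp (δ n * Complex.I)) atTop (nhds 1) := by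
    have : Continuous fun x : ℝ => Complex.exp (x * Complex.I) := by fun_prop
    simpa [Function.comp_def] using (this.tendsto 0).comp hδ0
  have hE : Tendsto (fun n : ℕ => (n:ℂ) * (Complex.exp (δ n * Complex.I) - 1)) atTop (nhds (t * Complex.I)) := by
    have hd : HasDerivAt (fun x : ℝ => Complex.exp (x * Complex.I)) Complex.I 0 := by
      have h1 : HasDerivAt (fun x : ℝ => (x:ℂ) * Complex.I) Complex.I 0 := by
        simpa using (Complex.ofRealCLM.hasDerivAt (x := (0:ℝ))).mul_const Complex.I
      simpa using h1.cexp
    have hs := (hasDerivAt_iff_tendsto_slope.mp hd)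
    have hs' : Tendsto (dslope (fun x : ℝ => Complex.exp (x * Complex.I)) 0) (nhds 0) (nhds Complex.I) := by
      have : ContinuousAt (dslope (fun x : ℝ => Complex.exp (x * Complex.I)) 0) 0 :=
        continuousAt_dslope_same.2 hd.differentiableAt
      have h2 := this.tendsto
      rwa [dslope_same, hd.deriv] at h2
    have h3 := (hs'.comp hδ0)
    have h4 : Tendsto (fun n : ℕ => (((n:ℝ) * δ n : ℝ) : ℂ)) atTop (nhds (t:ℂ)) :=
      (Complex.continuous_ofReal.tendsto t).comp h
    refine (h4.mul h3).congr fun n => ?_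
    have := sub_smul_dslope (fun x : ℝ => Complex.exp (x * Complex.I)) 0 (δ n)
    simp only [sub_zero, Complex.real_smul, Complex.ofReal_zero, zero_mul, Complex.exp_zero] at this
    simp only [Function.comp]
    rw [← this]; push_cast; ring
  have hr : Tendsto (fun n : ℕ => w n * ((n:ℂ) * (Complex.exp (δ n * Complex.I) - 1) + Complex.exp (δ n * Complex.I) - (t * Complex.I + 1))) atTop (nhds 0) := by
    have h5 := (hE.add hE0).sub_const (t * Complex.I + 1)
    rw [sub_self] at h5
    rw [tendsto_zero_iff_norm_tendsto_zero] at h5 ⊢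
    simpa [hw1] using h5
  have hc := hr.cesaro_smul
  have hsum : ∀ N : ℕ, ∑ n ∈ Finset.range N, w n * ((n:ℂ) * (Complex.exp (δ n * Complex.I) - 1) + Complex.exp (δ n * Complex.I) - (t * Complex.I + 1)) = N * w N - (t * Complex.I + 1) * ∑ n ∈ Finset.range N, w n := by
    intro N
    have hstep : ∀ n, w n * Complex.exp (δ n * Complex.I) = w (n+1) := by
      intro n
      simp only [hw, hδ, ← Complex.exp_add]; congr 1; push_cast; ring
    induction N with
    | zero => simp
    | succ N ih =>
      rw [Finset.sum_range_succ, ih, Finset.sum_range_succ, ← hstep N]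
      push_cast; ring
  simp only [hsum] at hc
  have ht' : 0 < |t| := abs_pos.2 ht
  have hev := hc.norm.eventually (Iio_mem_nhds (show ‖(0:ℂ)‖ < ε * |t| by rw [norm_zero]; positivity))
  filter_upwards [hev, eventually_gt_atTop 0] with N hN hN0
  have hN' : (0:ℝ) < N := by exact_mod_cast hN0
  rw [norm_smul, norm_inv, Real.norm_natCast, inv_mul_lt_iff₀ hN'] at hN
  have hb : |t| ≤ ‖(t * Complex.I + 1 : ℂ)‖ := by
    have := Complex.abs_im_le_norm (t * Complex.I + 1 : ℂ)
    simpa using this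
  have h6 : ‖(t * Complex.I + 1 : ℂ) * ∑ n ∈ Finset.range N, w n‖ ≤ N + N * (ε * |t|) := by
    have h7 := norm_sub_norm_le ((t * Complex.I + 1 : ℂ) * ∑ n ∈ Finset.range N, w n) (N * w N)
    rw [norm_sub_rev] at h7
    have h8 : ‖(N:ℂ) * w N‖ = N := by simp [hw1]
    linarith
  rw [norm_mul] at h6
  have h9 : |t| * ‖∑ n ∈ Finset.range N, w n‖ ≤ N + N * (ε * |t|) :=
    (mul_le_mul_of_nonneg_right hb (norm_nonneg _)).trans h6
  have h10 : (1 / |t| + ε) * N = (N + N * (ε * |t|)) / |t| := by field_simp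
  rw [h10, le_div_iff₀ ht']
  linarith

lemma shift_bound (u : ℕ → ℂ) (hu : ∀ n, ‖u n‖ = 1) (p N : ℕ) :
    ‖∑ n ∈ Finset.range N, u n - ∑ n ∈ Finset.range N, u (n+p)‖ ≤ 2 * p := by
  induction p with
  | zero => simp
  | succ p ih =>
    have h1 : ∑ n ∈ Finset.range N, u (n+p) - ∑ n ∈ Finset.range N, u (n+(p+1)) = u p - u (N+p) := by
      have := Finset.sum_range_sub' (fun n => u (n+p)) N
      rw [← Finset.sum_sub_distrib]
      simpa [add_assoc, add_comm, add_left_comm] using this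
    have h2 : ‖u p - u (N+p)‖ ≤ 2 := (norm_sub_le _ _).trans (by rw [hu, hu]; norm_num)
    calc _ = ‖(∑ n ∈ Finset.range N, u n - ∑ n ∈ Finset.range N, u (n+p)) + (u p - u (N+p))‖ := by
            rw [← h1]; congr 1; ring
      _ ≤ 2 * p + 2 := (norm_add_le _ _).trans (add_le_add ih h2)
      _ = _ := by push_cast; ring

lemma block_bound (u : ℕ → ℂ) (hu : ∀ n, ‖u n‖ = 1) (L N : ℕ) :
    L * ‖∑ n ∈ Finset.range N, u n‖ ≤ 2 * L^3 + ‖∑ n ∈ Finset.range N, ∑ i ∈ Finset.range L, u (n + i * L)‖ := by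
  rw [Finset.sum_comm]
  have h1 : (L:ℂ) * ∑ n ∈ Finset.range N, u n = ∑ i ∈ Finset.range L, (∑ n ∈ Finset.range N, u n - ∑ n ∈ Finset.range N, u (n + i * L)) + ∑ i ∈ Finset.range L, ∑ n ∈ Finset.range N, u (n + i * L) := by
    rw [Finset.sum_sub_distrib]; simp
  have h2 : ‖∑ i ∈ Finset.range L, (∑ n ∈ Finset.range N, u n - ∑ n ∈ Finset.range N, u (n + i * L))‖ ≤ 2 * L^3 := by
    refine (norm_sum_le _ _).trans ?_
    refine (Finset.sum_le_card_nsmul _ _ (2 * (L:ℝ)^2) fun i hi => ?_).trans ?_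
    · refine (shift_bound u hu _ _).trans ?_
      have : (i:ℝ) ≤ L := by exact_mod_cast (Finset.mem_range.1 hi).le
      push_cast
      nlinarith [Nat.cast_nonneg (α := ℝ) L]
    · simp; apply le_of_eq; ring
  calc _ = ‖(L:ℂ) * ∑ n ∈ Finset.range N, u n‖ := by simp
    _ ≤ _ := by rw [h1]; exact (norm_add_le _ _).trans (by gcongr)

lemma cs_bound (u : ℕ → ℂ) (L N : ℕ) :
    ‖∑ n ∈ Finset.range N, ∑ i ∈ Finset.range L, u (n + i * L)‖ ^ 2 ≤
      N * ∑ i ∈ Finset.range L, ∑ j ∈ Finset.range L,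
        ‖∑ n ∈ Finset.range N, u (n + i * L) * (starRingEnd ℂ) (u (n + j * L))‖ := by
  have h1 : ‖∑ n ∈ Finset.range N, ∑ i ∈ Finset.range L, u (n + i * L)‖ ^ 2 ≤
     N * ∑ n ∈ Finset.range N, ‖∑ i ∈ Finset.range L, u (n + i * L)‖^2 := by
    have := sq_sum_le_card_mul_sum_sq (s := Finset.range N) (f := fun n => ‖∑ i ∈ Finset.range L, u (n + i * L)‖)
    rw [Finset.card_range] at this
    refine le_trans ?_ this
    gcongr
    exact norm_sum_le _ _
  refine h1.trans ?_
  gcongr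
  have h2 : ((∑ n ∈ Finset.range N, ‖∑ i ∈ Finset.range L, u (n + i * L)‖^2 : ℝ) : ℂ) =
     ∑ i ∈ Finset.range L, ∑ j ∈ Finset.range L,
        ∑ n ∈ Finset.range N, u (n + i * L) * (starRingEnd ℂ) (u (n + j * L)) := by
    push_cast
    simp_rw [← Complex.mul_conj', map_sum, Finset.sum_mul_sum]
    rw [Finset.sum_comm]
    refine Finset.sum_congr rfl fun i _ => ?_
    rw [Finset.sum_comm]
  have h3 : (∑ n ∈ Finset.range N, ‖∑ i ∈ Finset.range L, u (n + i * L)‖^2 : ℝ) = ‖((∑ n ∈ Finset.range N, ‖∑ i ∈ Finset.range L, u (n + i * L)‖^2 : ℝ) : ℂ)‖ := by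
    rw [Complex.norm_real, Real.norm_of_nonneg (by positivity)]
  rw [h3, h2]
  refine (norm_sum_le _ _).trans ?_
  gcongr
  exact norm_sum_le _ _

lemma exp_mean (c : ℝ) (hc : c ≠ 0) :
    Tendsto (fun N : ℕ => (N:ℝ)⁻¹ • ∑ n ∈ Finset.range N, Complex.exp ((c * spF n : ℝ) * Complex.I)) atTop (nhds 0) := by
  set u : ℕ → ℂ := fun n => Complex.exp ((c * spF n : ℝ) * Complex.I) with hu_def
  have hu : ∀ n, ‖u n‖ = 1 := fun n => Complex.norm_exp_ofReal_mul_I _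
  have hc' : 0 < |c| := abs_pos.2 hc
  have corr : ∀ L : ℕ, 0 < L → ∀ i j : ℕ, ∀ᶠ N : ℕ in atTop,
      ‖∑ n ∈ Finset.range N, u (n + i * L) * (starRingEnd ℂ) (u (n + j * L))‖ ≤
        (if i = j then 1 else (1 / |c| + 1) / L) * N := by
    intro L hL i j
    have hL' : (0:ℝ) < L := by exact_mod_cast hL
    by_cases hij : i = j
    · refine Eventually.of_forall fun N => ?_
      rw [if_pos hij]
      refine (norm_sum_le _ _).trans ?_
      simp [hu]
    · simp only [if_neg hij]
      have h1 : Tendsto (fun n : ℕ => (n:ℝ) * ((c * (spF (n+1+i*L) - spF (n+1+j*L))) - c * (spF (n+i*L) - spF (n+j*L)))) atTop (nhds (c * (((i*L:ℕ):ℝ) - (j*L:ℕ)))) := by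
        refine ((first_diff (i*L) (j*L)).const_mul c).congr fun n => ?_
        ring
      have hij1 : (1:ℝ) ≤ |(i:ℝ) - j| := by
        have : (1:ℤ) ≤ |(i:ℤ) - j| := Int.one_le_abs (by omega)
        exact_mod_cast this
      have habs : |c| * L ≤ |c * (((i*L:ℕ):ℝ) - (j*L:ℕ))| := by
        push_cast
        rw [← sub_mul, abs_mul, abs_mul, abs_of_pos hL']
        nlinarith [mul_pos hc' hL']
      have hne : c * (((i*L:ℕ):ℝ) - (j*L:ℕ)) ≠ 0 := by
        rw [← abs_pos]; exact lt_of_lt_of_le (by positivity) habs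
      have h2 := mean_bound (fun n => c * (spF (n+i*L) - spF (n+j*L))) _ hne h1 (1/L) (by positivity)
      filter_upwards [h2] with N hN
      have e : ∀ n, u (n + i * L) * (starRingEnd ℂ) (u (n + j * L)) = Complex.exp ((c * (spF (n+i*L) - spF (n+j*L)) : ℝ) * Complex.I) := by
        intro n
        simp only [hu_def]
        rw [← Complex.exp_conj, ← Complex.exp_add]
        congr 1
        simp only [map_mul, Complex.conj_ofReal, Complex.conj_I]
        push_cast; ring
      simp only [e]
      refine hN.trans ?_
      gcongr
      have : 1 / |c * (((i*L:ℕ):ℝ) - (j*L:ℕ))| ≤ 1 / (|c| * L) := by gcongr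
      refine (add_le_add_left this _).trans (le_of_eq ?_)
      field_simp
  have sq_bd : ∀ L : ℕ, 0 < L → ∀ᶠ N : ℕ in atTop,
      ‖∑ n ∈ Finset.range N, ∑ i ∈ Finset.range L, u (n + i * L)‖ ^ 2 ≤ (2 + 1/|c|) * L * N^2 := by
    intro L hL
    have hL' : (0:ℝ) < L := by exact_mod_cast hL
    have h1 : ∀ᶠ N : ℕ in atTop, ∀ i ∈ Finset.range L, ∀ j ∈ Finset.range L, 
      ‖∑ n ∈ Finset.range N, u (n + i * L) * (starRingEnd ℂ) (u (n + j * L))‖ ≤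
        (if i = j then 1 else (1 / |c| + 1) / L) * N := by
      rw [Filter.eventually_all_finset]; intro i _
      rw [Filter.eventually_all_finset]; intro j _
      exact corr L hL i j
    filter_upwards [h1] with N hN
    refine (cs_bound u L N).trans ?_
    have h2 : ∑ i ∈ Finset.range L, ∑ j ∈ Finset.range L,
        ‖∑ n ∈ Finset.range N, u (n + i * L) * (starRingEnd ℂ) (u (n + j * L))‖ ≤ 
        ∑ i ∈ Finset.range L, ∑ j ∈ Finset.range L, ((if i = j then (1:ℝ) else 0) + (1 / |c| + 1) / L) * N := by
      refine Finset.sum_le_sum fun i hi => Finset.sum_le_sum fun j hj => (hN i hi j hj).trans ?_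
      gcongr
      split_ifs
      · have : 0 ≤ (1 / |c| + 1) / L := by positivity
        linarith
      · linarith
    have h3 : ∑ i ∈ Finset.range L, ∑ j ∈ Finset.range L, ((if i = j then (1:ℝ) else 0) + (1 / |c| + 1) / L) * N = (2 + 1/|c|) * L * N := by
      simp_rw [← Finset.sum_mul, Finset.sum_add_distrib]
      congr 1
      have : ∑ i ∈ Finset.range L, ∑ j ∈ Finset.range L, (if i = j then (1:ℝ) else 0) = L := by
        rw [Finset.sum_congr rfl (g := fun _ => (1:ℝ))]
        · simp
        · intro i hi
          rw [Finset.sum_ite_eq, if_pos hi]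
      rw [this]
      simp
      field_simp
      ring
    rw [h3] at h2
    calc _ ≤ (N:ℝ) * ((2 + 1/|c|) * L * N) := by gcongr
      _ = _ := by ring
  rw [tendsto_zero_iff_norm_tendsto_zero]
  rw [Metric.tendsto_atTop']
  intro ε hε
  obtain ⟨L, hL⟩ := exists_nat_gt (max 1 ((2 + 1/|c|) / (ε/2)^2))
  have hL1 : (1:ℝ) < L := (le_max_left _ _).trans_lt hL
  have hL0 : 0 < L := by have : (0:ℝ) < L := by linarith
                         exact_mod_cast this
  have hL2 : (2 + 1/|c|) < L * (ε/2)^2 := by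
    rw [← div_lt_iff₀ (by positivity)]; exact (le_max_right _ _).trans_lt hL
  obtain ⟨M, hM⟩ := exists_nat_gt (2 * (L:ℝ)^2 / (ε/2))
  have := (sq_bd L hL0).and (eventually_gt_atTop M)
  obtain ⟨N0, hN0⟩ := eventually_atTop.1 this
  refine ⟨N0, fun N hN => ?_⟩
  obtain ⟨h1, h2⟩ := hN0 N hN.le
  have h2' : (M:ℝ) < N := by exact_mod_cast h2
  have hNpos : (0:ℝ) < N := lt_of_le_of_lt (Nat.cast_nonneg _) h2'
  have h3 := block_bound u hu L N
  have h4 : ‖∑ n ∈ Finset.range N, ∑ i ∈ Finset.range L, u (n + i * L)‖ ≤ L * N * (ε/2) := by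
    refine (sq_le_sq₀ (norm_nonneg _) (by positivity)).1 ?_
    refine h1.trans ?_
    calc _ ≤ (L * (ε/2)^2) * L * N^2 := by gcongr
      _ = _ := by ring
  have h5 : 2 * (L:ℝ)^2 < N * (ε/2) := by
    rw [← div_lt_iff₀ (by positivity)]; linarith
  rw [dist_zero_right, norm_norm, norm_smul, norm_inv, Real.norm_natCast, inv_mul_lt_iff₀ hNpos]
  have h6 : (L:ℝ) * ‖∑ n ∈ Finset.range N, u n‖ < L * (N * ε) := by
    nlinarith
  exact lt_of_mul_lt_mul_left h6 (by positivity)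

lemma weyl_circle (μs : ℕ → MeasureTheory.ProbabilityMeasure UnitAddCircle)
    (μ : MeasureTheory.ProbabilityMeasure UnitAddCircle)
    (h : ∀ k : ℤ, Tendsto (fun N => ∫ x, (fourier k : C(UnitAddCircle, ℂ)) x ∂(μs N : MeasureTheory.Measure UnitAddCircle)) atTop
      (nhds (∫ x, (fourier k : C(UnitAddCircle, ℂ)) x ∂(μ : MeasureTheory.Measure UnitAddCircle)))) :
    Tendsto μs atTop (nhds μ) := by
  rw [MeasureTheory.ProbabilityMeasure.tendsto_iff_forall_integral_rclike_tendsto ℂ]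
  intro f
  have hIntegr : ∀ (g : C(UnitAddCircle, ℂ)) (ν : MeasureTheory.ProbabilityMeasure UnitAddCircle), MeasureTheory.Integrable g (ν : MeasureTheory.Measure UnitAddCircle) := by
    intro g ν
    exact (BoundedContinuousFunction.mkOfCompact g).integrable _
  have hspan : ∀ g ∈ Submodule.span ℂ (Set.range (fourier : ℤ → C(UnitAddCircle, ℂ))),
      Tendsto (fun N => ∫ x, g x ∂(μs N : MeasureTheory.Measure UnitAddCircle)) atTop
        (nhds (∫ x, g x ∂(μ : MeasureTheory.Measure UnitAddCircle))) := by
    intro g hg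
    induction hg using Submodule.span_induction with
    | mem x hx => obtain ⟨k, rfl⟩ := hx; exact h k
    | zero => simp
    | add x y _ _ hx hy =>
      simp only [ContinuousMap.add_apply]
      rw [MeasureTheory.integral_add (hIntegr _ _) (hIntegr _ _)]
      refine (hx.add hy).congr fun N => ?_
      rw [MeasureTheory.integral_add (hIntegr _ _) (hIntegr _ _)]
    | smul a x _ hx =>
      simp only [ContinuousMap.smul_apply, MeasureTheory.integral_smul]
      exact hx.const_smul a
  have hmem : f.toContinuousMap ∈ closure (Submodule.span ℂ (Set.range (fourier : ℤ → C(UnitAddCircle, ℂ))) : Set C(UnitAddCircle, ℂ)) := by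
    rw [← Submodule.topologicalClosure_coe, span_fourier_closure_eq_top]; trivial
  rw [Metric.tendsto_atTop]
  intro ε hε
  obtain ⟨g, hg, hfg⟩ := Metric.mem_closure_iff.1 hmem (ε/3) (by positivity)
  obtain ⟨N0, hN0⟩ := Metric.tendsto_atTop.1 (hspan g hg) (ε/3) (by positivity)
  have happ : ∀ ν : MeasureTheory.ProbabilityMeasure UnitAddCircle,
      dist (∫ x, f x ∂(ν : MeasureTheory.Measure UnitAddCircle)) (∫ x, g x ∂(ν : MeasureTheory.Measure UnitAddCircle)) ≤ ε/3 := by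
    intro ν
    rw [dist_eq_norm, ← MeasureTheory.integral_sub (f.integrable _) (hIntegr _ _)]
    refine (MeasureTheory.norm_integral_le_of_norm_le_const (C := ε/3) (Eventually.of_forall fun x => ?_)).trans ?_
    · rw [← dist_eq_norm]
      exact (ContinuousMap.dist_apply_le_dist (f := f.toContinuousMap) (g := g) x).trans hfg.le
    · simp
  refine ⟨N0, fun N hN => ?_⟩
  have h1 := happ (μs N)
  have h2 := happ μ
  have h3 := hN0 N hN
  rw [dist_comm] at h2
  have := dist_triangle4 (∫ x, f x ∂(μs N : MeasureTheory.Measure UnitAddCircle)) (∫ x, g x ∂(μs N : MeasureTheory.Measure UnitAddCircle)) (∫ x, g x ∂(μ : MeasureTheory.Measure UnitAddCircle)) (∫ x, f x ∂(μ : MeasureTheory.Measure UnitAddCircle))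
  linarith

lemma haar_fourier (k : ℤ) : ∫ x, (fourier k : C(UnitAddCircle, ℂ)) x ∂AddCircle.haarAddCircle = if k = 0 then 1 else 0 := by
  split_ifs with h
  · subst h; simp
  · exact MeasureTheory.integral_eq_zero_of_add_right_eq_neg (μ := AddCircle.haarAddCircle)
      (fourier_add_half_inv_index h one_pos)

lemma arc_frontier (a b : ℝ) :
    frontier ((fun x : ℝ => (x : UnitAddCircle)) '' Set.Ico a b) ⊆ {(a : UnitAddCircle), (b : UnitAddCircle)} := by
  have hcl : closure ((fun x : ℝ => (x : UnitAddCircle)) '' Set.Ico a b) ⊆ (fun x : ℝ => (x : UnitAddCircle)) '' Set.Icc a b :=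
    closure_minimal (Set.image_mono Set.Ico_subset_Icc_self)
      (isCompact_Icc.image (AddCircle.continuous_mk' 1)).isClosed
  have hop : (fun x : ℝ => (x : UnitAddCircle)) '' Set.Ioo a b ⊆ interior ((fun x : ℝ => (x : UnitAddCircle)) '' Set.Ico a b) :=
    interior_maximal (Set.image_mono Set.Ioo_subset_Ico_self) (QuotientAddGroup.isOpenMap_coe _ isOpen_Ioo)
  rintro y ⟨hy1, hy2⟩
  obtain ⟨x, hx, rfl⟩ := hcl hy1
  rcases eq_or_lt_of_le hx.1 with h | h
  · left; simp [h]
  rcases eq_or_lt_of_le hx.2 with h' | h'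
  · right; simp [h']
  · exact absurd (hop ⟨x, ⟨h, h'⟩, rfl⟩) hy2

lemma mem_arc (a b x : ℝ) (ha : 0 ≤ a) (hb : b ≤ 1) :
    (x : UnitAddCircle) ∈ (fun x : ℝ => (x : UnitAddCircle)) '' Set.Ico a b ↔ Int.fract x ∈ Set.Ico a b := by
  have hx : ((Int.fract x : ℝ) : UnitAddCircle) = (x : UnitAddCircle) := by
    have h0 : (((⌊x⌋ : ℤ) : ℝ) : UnitAddCircle) = 0 := (AddCircle.coe_eq_zero_iff _).2 ⟨⌊x⌋, by simp⟩
    rw [← Int.self_sub_floor, AddCircle.coe_sub, h0, sub_zero]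
  constructor
  · rintro ⟨y, hy, hxy⟩
    have : Int.fract x = y := by
      rw [← AddCircle.coe_eq_coe_iff_of_mem_Ico (p := (1:ℝ)) (a := 0), hx]
      · exact hxy.symm
      · rw [zero_add]; exact ⟨Int.fract_nonneg x, Int.fract_lt_one x⟩
      · simpa using ⟨ha.trans hy.1, hy.2.trans_le hb⟩
    rwa [this]
  · intro h
    exact ⟨_, h, hx⟩

lemma haar_eq_vol : (AddCircle.haarAddCircle : MeasureTheory.Measure UnitAddCircle) = MeasureTheory.volume := by
  rw [AddCircle.volume_eq_smul_haarAddCircle]; simp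

lemma haar_arc (a b : ℝ) (ha : 0 ≤ a) (hab : a < b) (hb : b ≤ 1) :
    (AddCircle.haarAddCircle : MeasureTheory.Measure UnitAddCircle) ((fun x : ℝ => (x : UnitAddCircle)) '' Set.Ico a b) = ENNReal.ofReal (b - a) := by
  have hms : MeasurableSet ((fun x : ℝ => (x : UnitAddCircle)) '' Set.Ico a b) := by
    have : (fun x : ℝ => (x : UnitAddCircle)) '' Set.Ico a b = insert (a : UnitAddCircle) ((fun x : ℝ => (x : UnitAddCircle)) '' Set.Ioo a b) := by
      rw [← Set.Ioo_insert_left hab, Set.image_insert_eq]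
    rw [this]
    exact ((QuotientAddGroup.isOpenMap_coe _ isOpen_Ioo).measurableSet).insert _
  rw [haar_eq_vol, ← (UnitAddCircle.measurePreserving_mk 0).measure_preimage hms.nullMeasurableSet]
  have e : MeasureTheory.Measure.restrict MeasureTheory.volume (Set.Ioc (0:ℝ) (0+1)) = MeasureTheory.Measure.restrict MeasureTheory.volume (Set.Ico (0:ℝ) 1) := by
    rw [zero_add]; exact MeasureTheory.restrict_Ico_eq_restrict_Ioc.symm
  rw [e, MeasureTheory.Measure.restrict_apply (AddCircle.measurable_mk' hms)]
  have : QuotientAddGroup.mk ⁻¹' ((fun x : ℝ => (x : UnitAddCircle)) '' Set.Ico a b) ∩ Set.Ico (0:ℝ) 1 = Set.Ico a b := by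
    ext x
    rw [Set.mem_inter_iff, Set.mem_preimage]
    rw [show (QuotientAddGroup.mk x : UnitAddCircle) = (x : UnitAddCircle) from rfl, mem_arc a b x ha hb]
    constructor
    · rintro ⟨h1, h2⟩
      rwa [Int.fract_eq_self.2 ⟨h2.1, h2.2⟩] at h1
    · intro h
      have h2 : x ∈ Set.Ico (0:ℝ) 1 := ⟨ha.trans h.1, h.2.trans_le hb⟩
      rw [Int.fract_eq_self.2 ⟨h2.1, h2.2⟩]
      exact ⟨h, h2⟩
  rw [this, Real.volume_Ico]

lemma weyl_count (x : ℕ → ℝ)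
    (h : ∀ k : ℤ, k ≠ 0 → Tendsto (fun N : ℕ => (N:ℝ)⁻¹ • ∑ n ∈ Finset.range N, Complex.exp ((2 * Real.pi * k * x n : ℝ) * Complex.I)) atTop (nhds 0))
    (a b : ℝ) (ha : 0 ≤ a) (hab : a < b) (hb : b ≤ 1) :
    Tendsto (fun N : ℕ => (((Finset.range (N+1)).filter fun n => Int.fract (x n) ∈ Set.Ico a b).card : ℝ) / ((N:ℝ)+1)) atTop (nhds (b - a)) := by
  let m : ℕ → MeasureTheory.Measure UnitAddCircle := fun N =>
    ((N:ENNReal)+1)⁻¹ • ∑ n ∈ Finset.range (N+1), MeasureTheory.Measure.dirac (x n : UnitAddCircle)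
  have hm : ∀ N, MeasureTheory.IsProbabilityMeasure (m N) := by
    intro N
    constructor
    simp only [m, MeasureTheory.Measure.smul_apply, MeasureTheory.Measure.finsetSum_apply]
    simp
    exact ENNReal.inv_mul_cancel (by simp) (by finiteness)
  let μs : ℕ → MeasureTheory.ProbabilityMeasure UnitAddCircle := fun N => ⟨m N, hm N⟩
  let μ : MeasureTheory.ProbabilityMeasure UnitAddCircle := ⟨AddCircle.haarAddCircle, inferInstance⟩
  have hconv : Tendsto μs atTop (nhds μ) := by
    apply weyl_circle
    intro k
    show Tendsto (fun N => ∫ y, (fourier k : C(UnitAddCircle, ℂ)) y ∂(m N)) atTop (nhds (∫ y, (fourier k : C(UnitAddCircle, ℂ)) y ∂AddCircle.haarAddCircle))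
    rw [haar_fourier]
    split_ifs with hk
    · subst hk
      simp
    · refine ((tendsto_add_atTop_iff_nat 1).2 (h k hk)).congr fun N => ?_
      simp only [m]
      rw [MeasureTheory.integral_smul_measure, MeasureTheory.integral_finsetSum_measure]
      · congr 1
        · rw [ENNReal.toReal_inv, ENNReal.toReal_add (by finiteness) (by finiteness)]; simp
        · refine Finset.sum_congr rfl fun n _ => ?_
          rw [MeasureTheory.integral_dirac, fourier_coe_apply]
          congr 1; push_cast; ring
      · intro n _
        exact (BoundedContinuousFunction.mkOfCompact (fourier k : C(UnitAddCircle, ℂ))).integrable _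
  have hfr : (μ : MeasureTheory.Measure UnitAddCircle) (frontier ((fun x : ℝ => (x : UnitAddCircle)) '' Set.Ico a b)) = 0 := by
    refine MeasureTheory.measure_mono_null (arc_frontier a b) ?_
    show (AddCircle.haarAddCircle : MeasureTheory.Measure UnitAddCircle) _ = 0
    rw [haar_eq_vol]
    have hs : ∀ y : UnitAddCircle, MeasureTheory.volume ({y} : Set UnitAddCircle) = 0 := by
      intro y
      rw [← Metric.closedBall_zero, AddCircle.volume_closedBall]
      simp
    rw [Set.insert_eq]
    exact MeasureTheory.measure_union_null (hs _) (hs _)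
  have key := MeasureTheory.ProbabilityMeasure.tendsto_measure_of_null_frontier_of_tendsto' hconv hfr
  have hms : MeasurableSet ((fun x : ℝ => (x : UnitAddCircle)) '' Set.Ico a b) := by
    have : (fun x : ℝ => (x : UnitAddCircle)) '' Set.Ico a b = insert (a : UnitAddCircle) ((fun x : ℝ => (x : UnitAddCircle)) '' Set.Ioo a b) := by
      rw [← Set.Ioo_insert_left hab, Set.image_insert_eq]
    rw [this]
    exact ((QuotientAddGroup.isOpenMap_coe _ isOpen_Ioo).measurableSet).insert _
  change Tendsto (fun N => m N _) atTop (nhds ((AddCircle.haarAddCircle : MeasureTheory.Measure UnitAddCircle) _)) at key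
  rw [haar_arc a b ha hab hb] at key
  have key2 := (ENNReal.tendsto_toReal ENNReal.ofReal_ne_top).comp key
  rw [ENNReal.toReal_ofReal (by linarith)] at key2
  refine key2.congr fun N => ?_
  simp only [Function.comp, m, MeasureTheory.Measure.smul_apply, MeasureTheory.Measure.finsetSum_apply, smul_eq_mul, ENNReal.toReal_mul]
  have e1 : ((N:ENNReal)+1)⁻¹.toReal = ((N:ℝ)+1)⁻¹ := by
    rw [ENNReal.toReal_inv, ENNReal.toReal_add (by finiteness) (by finiteness)]; simp
  rw [e1, div_eq_inv_mul]
  congr 1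
  rw [ENNReal.toReal_sum (fun n _ => by finiteness), Finset.card_filter]
  push_cast
  refine Finset.sum_congr rfl fun n _ => ?_
  rw [MeasureTheory.Measure.dirac_apply' _ hms, Set.indicator_apply]
  simp only [mem_arc a b (x n) ha hb]
  split_ifs <;> simp

lemma card_split (P : ℕ → Prop) [DecidablePred P] (N : ℕ) :
    (((Finset.range (N+1)).filter P).card : ℝ) = (((Finset.Icc 1 N).filter P).card : ℝ) + (if P 0 then 1 else 0) := by
  have : Finset.range (N+1) = insert 0 (Finset.Icc 1 N) := by
    ext n; simp only [Finset.mem_range, Finset.mem_insert, Finset.mem_Icc]; omega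
  rw [Finset.card_filter, Finset.card_filter, this, Finset.sum_insert (by simp)]
  push_cast
  ring

/-- The self-powered sequence `n ↦ nⁿ` obeys Benford's Law in the limit. -/
theorem self_powered_benford :
    ∀ d ∈ Finset.Icc (1 : ℕ) 9,
      Tendsto (fun N : ℕ =>
          (((Finset.Icc 1 N).filter fun n =>
            Int.fract (Real.logb 10 ((n ^ n : ℕ) : ℝ))
              ∈ Set.Ico (Real.logb 10 (d : ℝ)) (Real.logb 10 ((d : ℝ) + 1))).card : ℝ)
            / (N : ℝ))
        atTop (nhds (Real.logb 10 (1 + 1 / (d : ℝ)))) := by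
  intro d hd
  rw [Finset.mem_Icc] at hd
  have hd1 : (1:ℝ) ≤ d := by exact_mod_cast hd.1
  have hd9 : (d:ℝ) ≤ 9 := by exact_mod_cast hd.2
  have ha : 0 ≤ Real.logb 10 (d:ℝ) := Real.logb_nonneg (by norm_num) hd1
  have hab : Real.logb 10 (d:ℝ) < Real.logb 10 ((d:ℝ)+1) :=
    Real.logb_lt_logb (by norm_num) (by linarith) (by linarith)
  have hb : Real.logb 10 ((d:ℝ)+1) ≤ 1 := by
    rw [Real.logb_le_iff_le_rpow (by norm_num) (by linarith), Real.rpow_one]; linarith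
  have hval : Real.logb 10 (1 + 1 / (d:ℝ)) = Real.logb 10 ((d:ℝ)+1) - Real.logb 10 (d:ℝ) := by
    rw [← Real.logb_div (by positivity) (by positivity)]; congr 1; field_simp
  rw [hval]
  have hlog : 0 < Real.log 10 := Real.log_pos (by norm_num)
  have hx : ∀ n : ℕ, Real.logb 10 ((n ^ n : ℕ) : ℝ) = spF n / Real.log 10 := by
    intro n
    rw [Real.logb, Nat.cast_pow, Real.log_pow, spF]
  have hw := weyl_count (fun n => Real.logb 10 ((n ^ n : ℕ) : ℝ)) (by
    intro k hk
    have hk' : (k:ℝ) ≠ 0 := by exact_mod_cast hk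
    have hc : 2 * Real.pi * k / Real.log 10 ≠ 0 := by
      have := Real.pi_ne_zero
      positivity
    refine (exp_mean _ hc).congr fun N => ?_
    congr 1
    refine Finset.sum_congr rfl fun n _ => ?_
    rw [hx]
    congr 3
    ring) _ _ ha hab hb
  set P : ℕ → Prop := fun n => Int.fract (Real.logb 10 ((n ^ n : ℕ) : ℝ))
              ∈ Set.Ico (Real.logb 10 (d : ℝ)) (Real.logb 10 ((d : ℝ) + 1)) with hP
  have hcard : ∀ N : ℕ, (((Finset.range (N+1)).filter P).card : ℝ) = (((Finset.Icc 1 N).filter P).card : ℝ) + (if P 0 then 1 else 0) := by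
    exact fun N => card_split P N
  have h1 : Tendsto (fun N : ℕ => ((N:ℝ)+1)/N) atTop (nhds 1) := by
    have := (tendsto_natCast_div_add_atTop (1:ℝ)).inv₀ one_ne_zero
    simpa using this
  have h2 : Tendsto (fun N : ℕ => (if P 0 then (1:ℝ) else 0) / N) atTop (nhds 0) :=
    tendsto_const_div_atTop_nhds_zero_nat _
  have h3 := (hw.mul h1).sub h2
  rw [mul_one, sub_zero] at h3
  refine h3.congr' ?_
  filter_upwards [eventually_gt_atTop 0] with N hN
  have hN' : (0:ℝ) < N := by exact_mod_cast hN
  change (((Finset.range (N+1)).filter P).card : ℝ) / ((N:ℝ)+1) * (((N:ℝ)+1)/N) - _ = _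
  rw [hcard]
  field_simp
  ring
end
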